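/- Let d ≥ 1, q ≥ 2, α > d, J > 0, and let ψ : ZMod q → ℝ satisfy ψ(0) = 0, 0 ≤ ψ(n) ≤ 1 for all n, and ψ(n) ≥ m for all n ≠ 0, where m ≥ 0. Let σ : ℤ^d → ZMod q, let S ⊂ ℤ^d be a finite set such that every point of S is incorrect for σ, and such that for every z ∈ S every incorrect point lying in B₁(z) also belongs to S. Then (1/2)·∑_{x∈S} ∑'_{y∈ℤ^d} J_{xy}·ψ(σ_x−σ_y) + (1/2)·∑_{x∈S} ∑'_{y∉S} J_{xy}·ψ(σ_x−σ_y) ≥ (m/((2d+1)·2^{α+1}))·(J·c_α·|S| + F_S), where all the infinite sums are convergent tsums. -/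

import Mathlib

open scoped BigOperators

noncomputable section

/-- The lattice `ℤ^d`. -/
abbrev Zd (d : ℕ) := Fin d → ℤ

/-- The ℓ¹-norm on `ℤ^d`. -/
def l1 {d : ℕ} (x : Zd d) : ℤ := ∑ i, |x i|

/-- The closed ℓ¹-ball of radius 1 centred at `x` (a finite set of `2d+1` points). -/
def ball1 {d : ℕ} (x : Zd d) : Finset (Zd d) :=
  ((Fintype.piFinset fun _ : Fin d => ({-1, 0, 1} : Finset ℤ)).image (fun v => x + v)).filter
    (fun y => l1 (y - x) ≤ 1)

/-- Long-range couplings `J_{xy} = J / |x-y|^α` for `x ≠ y`, and `J_{xx} = 0`. -/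
noncomputable def Jcoup (d : ℕ) (J α : ℝ) (x y : Zd d) : ℝ :=
  if x = y then 0 else J / ((l1 (x - y) : ℝ) ^ α)

/-- A point `x` is `r`-correct for `σ` if `σ` equals `r` on the whole unit ball `B₁(x)`. -/
def IsCorrect {d q : ℕ} (σ : Zd d → ZMod q) (r : ZMod q) (x : Zd d) : Prop :=
  ∀ y ∈ ball1 x, σ y = r

/-- A point is incorrect for `σ` if it is `r`-correct for no colour `r`. -/
def IsIncorrect {d q : ℕ} (σ : Zd d → ZMod q) (x : Zd d) : Prop :=
  ∀ r : ZMod q, ¬ IsCorrect σ r x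

/-- `c_α = ∑_{y ∈ ℤ^d, y ≠ 0} |y|^{-α}` (a convergent sum when `α > d`). -/
noncomputable def cAlpha (d : ℕ) (α : ℝ) : ℝ :=
  ∑' y : Zd d, (if y = 0 then 0 else 1 / ((l1 y : ℝ) ^ α))

/-- `F_S = ∑_{x∈S} ∑_{y∉S} J_{xy}` (a convergent sum when `α > d`). -/
noncomputable def Fterm (d : ℕ) (J α : ℝ) (S : Finset (Zd d)) : ℝ :=
  ∑ x ∈ S, ∑' y : Zd d, (if y ∈ S then 0 else Jcoup d J α x y)

theorem l1_nonneg {d : ℕ} (x : Zd d) : 0 ≤ l1 x :=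
  Finset.sum_nonneg fun _ _ => abs_nonneg _

theorem l1_neg {d : ℕ} (x : Zd d) : l1 (-x) = l1 x := by
  simp [l1]

theorem l1_add_le {d : ℕ} (x y : Zd d) : l1 (x + y) ≤ l1 x + l1 y := by
  unfold l1
  rw [← Finset.sum_add_distrib]
  exact Finset.sum_le_sum fun i _ => abs_add_le (x i) (y i)

theorem abs_apply_le_l1 {d : ℕ} (x : Zd d) (i : Fin d) : |x i| ≤ l1 x :=
  Finset.single_le_sum (f := fun i => |x i|) (fun _ _ => abs_nonneg _) (Finset.mem_univ i)

theorem l1_pos {d : ℕ} {x : Zd d} (hx : x ≠ 0) : 0 < l1 x := by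
  obtain ⟨i, hi⟩ := Function.ne_iff.mp hx
  exact (abs_pos.mpr hi).trans_le (abs_apply_le_l1 x i)

theorem mem_ball1 {d : ℕ} {x y : Zd d} : y ∈ ball1 x ↔ l1 (y - x) ≤ 1 := by
  simp only [ball1, Finset.mem_filter, Finset.mem_image, Fintype.mem_piFinset,
    and_iff_right_iff_imp]
  refine fun h => ⟨y - x, fun i => ?_, by simp⟩
  have := abs_le.mp ((abs_apply_le_l1 (y - x) i).trans h)
  simp only [Finset.mem_insert, Finset.mem_singleton]
  omega

theorem mem_ball1_comm {d : ℕ} {x y : Zd d} : y ∈ ball1 x ↔ x ∈ ball1 y := by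
  rw [mem_ball1, mem_ball1, ← l1_neg, neg_sub]

theorem self_mem_ball1 {d : ℕ} (x : Zd d) : x ∈ ball1 x := by
  simp [mem_ball1, l1]

theorem eq_zero_or_single_of_l1_le_one {d : ℕ} {v : Zd d} (h : l1 v ≤ 1) :
    v = 0 ∨ ∃ i, v = Pi.single i 1 ∨ v = Pi.single i (-1) := by
  by_cases hv : v = 0
  · exact Or.inl hv
  obtain ⟨i, hi⟩ := Function.ne_iff.mp hv
  have hi1 : 1 ≤ |v i| := Int.one_le_abs hi
  have hrest : ∀ j, j ≠ i → v j = 0 := by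
    intro j hj
    have hpair : |v i| + |v j| ≤ l1 v := by
      rw [← Finset.sum_pair (f := fun k => |v k|) hj.symm]
      exact Finset.sum_le_sum_of_subset_of_nonneg (Finset.subset_univ _)
        fun _ _ _ => abs_nonneg _
    exact abs_nonpos_iff.mp (by omega)
  have hsingle : v = Pi.single i (v i) := by
    ext j
    by_cases hj : j = i
    · subst hj; simp
    · simp [hj, hrest j hj]
  have hi2 : |v i| = 1 := le_antisymm ((abs_apply_le_l1 v i).trans h) hi1
  refine Or.inr ⟨i, ?_⟩
  rcases (abs_eq zero_le_one).mp hi2 with h1 | h1 <;> rw [h1] at hsingle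
  · exact Or.inl hsingle
  · exact Or.inr hsingle

theorem card_ball1_le {d : ℕ} (x : Zd d) : (ball1 x).card ≤ 2 * d + 1 := by
  classical
  have hsub : ball1 x ⊆ insert x
      ((Finset.univ : Finset (Fin d)).image (fun i => x + Pi.single i 1) ∪
        (Finset.univ : Finset (Fin d)).image (fun i => x + Pi.single i (-1))) := by
    intro y hy
    simp only [Finset.mem_insert, Finset.mem_union, Finset.mem_image, Finset.mem_univ, true_and]
    rcases eq_zero_or_single_of_l1_le_one (mem_ball1.mp hy) with h | ⟨i, h | h⟩
    · exact Or.inl (sub_eq_zero.mp h)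
    · exact Or.inr (Or.inl ⟨i, by rw [← h]; abel⟩)
    · exact Or.inr (Or.inr ⟨i, by rw [← h]; abel⟩)
  refine (Finset.card_le_card hsub).trans ((Finset.card_insert_le _ _).trans ?_)
  have h1 := Finset.card_union_le
    ((Finset.univ : Finset (Fin d)).image (fun i => x + Pi.single i 1))
    ((Finset.univ : Finset (Fin d)).image (fun i => x + Pi.single i (-1)))
  have h2 := Finset.card_image_le (s := (Finset.univ : Finset (Fin d)))
    (f := fun i => x + Pi.single i (1 : ℤ))
  have h3 := Finset.card_image_le (s := (Finset.univ : Finset (Fin d)))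
    (f := fun i => x + Pi.single i (-1 : ℤ))
  simp only [Finset.card_univ, Fintype.card_fin] at h2 h3
  omega

theorem summable_norm_rpow_int_pi {d : ℕ} {r : ℝ} (hr : r < -d) :
    Summable fun x : Zd d => ‖x‖ ^ r := by
  let b := Pi.basisFun ℝ (Fin d)
  let L := Submodule.span ℤ (Set.range b)
  have hrank : Module.finrank ℤ L = d := by
    rw [ZLattice.rank ℝ L]; simp
  let f : Zd d → L := fun x => ⟨fun i => (x i : ℝ), by
    refine (b.mem_span_iff_repr_mem ℤ _).mpr fun i => ⟨x i, ?_⟩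
    simp [b]⟩
  have hf : Function.Injective f := by
    intro x y hxy
    ext i
    have h : (x i : ℝ) = y i := congrFun (congrArg Subtype.val hxy) i
    exact_mod_cast h
  have hsum := (ZLattice.summable_norm_rpow L r (by rwa [hrank])).comp_injective hf
  exact hsum.congr fun x => by congr 1

theorem norm_le_l1 {d : ℕ} (x : Zd d) : ‖x‖ ≤ (l1 x : ℝ) := by
  refine (pi_norm_le_iff_of_nonneg (by exact_mod_cast l1_nonneg x)).mpr fun i => ?_
  rw [Int.norm_eq_abs]
  exact_mod_cast abs_apply_le_l1 x i

theorem summable_cAlpha {d : ℕ} {α : ℝ} (hα : (d : ℝ) < α) :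
    Summable fun y : Zd d => if y = 0 then 0 else 1 / ((l1 y : ℝ) ^ α) := by
  refine (summable_norm_rpow_int_pi (neg_lt_neg hα)).of_nonneg_of_le (fun y => ?_) fun y => ?_
  · have : (0 : ℝ) ≤ l1 y := by exact_mod_cast l1_nonneg y
    split_ifs <;> positivity
  · split_ifs with hy
    · positivity
    · have hα0 : 0 ≤ α := (Nat.cast_nonneg d).trans hα.le
      have hpos : 0 < ‖y‖ := norm_pos_iff.mpr hy
      rw [Real.rpow_neg hpos.le, one_div]
      exact inv_anti₀ (by positivity) (Real.rpow_le_rpow hpos.le (norm_le_l1 y) hα0)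

theorem Jcoup_eq {d : ℕ} (J α : ℝ) (x y : Zd d) :
    Jcoup d J α x y = J * (if x - y = 0 then 0 else 1 / ((l1 (x - y) : ℝ) ^ α)) := by
  unfold Jcoup
  by_cases h : x = y
  · simp [h]
  · simp [h, sub_eq_zero, div_eq_mul_inv]

theorem Jcoup_nonneg {d : ℕ} {J : ℝ} (hJ : 0 ≤ J) (α : ℝ) (x y : Zd d) :
    0 ≤ Jcoup d J α x y := by
  have : (0 : ℝ) ≤ l1 (x - y) := by exact_mod_cast l1_nonneg _
  unfold Jcoup
  split_ifs <;> positivity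

theorem summable_Jcoup {d : ℕ} (J : ℝ) {α : ℝ} (hα : (d : ℝ) < α) (x : Zd d) :
    Summable (Jcoup d J α x) := by
  refine (((Equiv.subLeft x).summable_iff.mpr (summable_cAlpha hα)).mul_left J).congr fun y => ?_
  exact (Jcoup_eq J α x y).symm

theorem tsum_Jcoup {d : ℕ} (J α : ℝ) (x : Zd d) :
    ∑' y, Jcoup d J α x y = J * cAlpha d α := by
  rw [cAlpha, ← (Equiv.subLeft x).tsum_eq (fun y : Zd d => if y = 0 then 0 else _), ← tsum_mul_left]
  exact tsum_congr fun y => Jcoup_eq J α x y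

/-- Moving one endpoint of a coupling to a neighbouring site costs at most a factor `2 ^ α`. -/
theorem Jcoup_le_of_mem_ball1 {d : ℕ} {J α : ℝ} (hJ : 0 ≤ J) (hα : 0 ≤ α) {x y z : Zd d}
    (hz : z ∈ ball1 x) (hzy : z ≠ y) :
    Jcoup d J α x y ≤ 2 ^ α * Jcoup d J α z y := by
  by_cases hxy : x = y
  · simpa [Jcoup, hxy] using mul_nonneg (by positivity) (Jcoup_nonneg hJ α z y)
  have h1 : 0 < l1 (x - y) := l1_pos (sub_ne_zero.mpr hxy)
  have h2 : 0 < l1 (z - y) := l1_pos (sub_ne_zero.mpr hzy)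
  have h3 : l1 (z - y) ≤ l1 (z - x) + l1 (x - y) := by
    simpa using l1_add_le (z - x) (x - y)
  have h4 : l1 (z - y) ≤ 2 * l1 (x - y) := by
    have := mem_ball1.mp hz
    omega
  have h1' : (0 : ℝ) < l1 (x - y) := by exact_mod_cast h1
  have h2' : (0 : ℝ) < l1 (z - y) := by exact_mod_cast h2
  have h4' : (l1 (z - y) : ℝ) ≤ 2 * l1 (x - y) := by exact_mod_cast h4
  have h5 := Real.rpow_le_rpow h2'.le h4' hα
  rw [Real.mul_rpow zero_le_two h1'.le] at h5
  rw [Jcoup, Jcoup, if_neg hxy, if_neg hzy, ← mul_div_assoc,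
    div_le_div_iff₀ (by positivity) (by positivity)]
  calc J * (l1 (z - y) : ℝ) ^ α ≤ J * (2 ^ α * (l1 (x - y) : ℝ) ^ α) :=
        mul_le_mul_of_nonneg_left h5 hJ
    _ = 2 ^ α * J * (l1 (x - y) : ℝ) ^ α := by ring

theorem isIncorrect_of_ne {d q : ℕ} {σ : Zd d → ZMod q} {x z : Zd d} (hz : z ∈ ball1 x)
    (hne : σ z ≠ σ x) : IsIncorrect σ z := fun _ h =>
  hne ((h z (self_mem_ball1 z)).trans (h x (mem_ball1_comm.mp hz)).symm)

/-- Around a point of `S` one finds, inside `S`, a neighbour disagreeing with any given colour. -/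
theorem exists_mem_ball1_ne {d q : ℕ} {σ : Zd d → ZMod q} {S : Finset (Zd d)}
    (hinc : ∀ z ∈ S, IsIncorrect σ z)
    (hclosed : ∀ z ∈ S, ∀ w ∈ ball1 z, IsIncorrect σ w → w ∈ S)
    {x : Zd d} (hx : x ∈ S) (r : ZMod q) : ∃ z ∈ S, z ∈ ball1 x ∧ σ z ≠ r := by
  by_cases h : σ x = r
  · have h_not := hinc x hx r
    unfold IsCorrect at h_not
    push Not at h_not
    obtain ⟨z, hz, hne⟩ := h_not
    exact ⟨z, hclosed x hx z hz (isIncorrect_of_ne hz (h ▸ hne)), hz, hne⟩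
  · exact ⟨x, hx, self_mem_ball1 x, h⟩

theorem sum_Jcoup_le {d q : ℕ} {J α m : ℝ} (hJ : 0 ≤ J) (hα : 0 ≤ α)
    {ψ : ZMod q → ℝ} (hψnonneg : ∀ n, 0 ≤ ψ n) (hψm : ∀ n : ZMod q, n ≠ 0 → m ≤ ψ n)
    {σ : Zd d → ZMod q} {S : Finset (Zd d)} (hinc : ∀ z ∈ S, IsIncorrect σ z)
    (hclosed : ∀ z ∈ S, ∀ w ∈ ball1 z, IsIncorrect σ w → w ∈ S) (y : Zd d) :
    m * ∑ x ∈ S, Jcoup d J α x y ≤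
      ((2 * d + 1 : ℕ) : ℝ) * 2 ^ α * ∑ x ∈ S, Jcoup d J α x y * ψ (σ x - σ y) := by
  set g : Zd d → ℝ := fun z => Jcoup d J α z y * ψ (σ z - σ y)
  have hg : ∀ z, 0 ≤ g z := fun z => mul_nonneg (Jcoup_nonneg hJ α z y) (hψnonneg _)
  have hlocal : ∀ x ∈ S,
      m * Jcoup d J α x y ≤ 2 ^ α * ∑ z ∈ S, if z ∈ ball1 x then g z else 0 := by
    intro x hx
    obtain ⟨z, hzS, hzx, hne⟩ := exists_mem_ball1_ne hinc hclosed hx (σ y)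
    have hmψ : m ≤ ψ (σ z - σ y) := hψm _ (sub_ne_zero.mpr hne)
    have hle : g z ≤ ∑ z ∈ S, if z ∈ ball1 x then g z else 0 := by
      refine le_trans (by simp [hzx]) (Finset.single_le_sum
        (f := fun z => if z ∈ ball1 x then g z else 0) (fun w _ => ?_) hzS)
      split_ifs
      exacts [hg w, le_rfl]
    calc m * Jcoup d J α x y ≤ ψ (σ z - σ y) * Jcoup d J α x y :=
          mul_le_mul_of_nonneg_right hmψ (Jcoup_nonneg hJ α x y)
      _ ≤ ψ (σ z - σ y) * (2 ^ α * Jcoup d J α z y) :=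
          mul_le_mul_of_nonneg_left
            (Jcoup_le_of_mem_ball1 hJ hα hzx fun h => hne (congrArg σ h)) (hψnonneg _)
      _ = 2 ^ α * g z := by simp only [g]; ring
      _ ≤ _ := mul_le_mul_of_nonneg_left hle (by positivity)
  have hcount : ∀ z ∈ S,
      (∑ x ∈ S, if z ∈ ball1 x then g z else 0) ≤ ((2 * d + 1 : ℕ) : ℝ) * g z := by
    intro z _
    rw [← Finset.sum_filter, Finset.sum_const, nsmul_eq_mul]
    refine mul_le_mul_of_nonneg_right (Nat.cast_le.mpr ?_) (hg z)
    exact (Finset.card_le_card fun x hx => mem_ball1_comm.mp (Finset.mem_filter.mp hx).2).trans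
      (card_ball1_le z)
  calc m * ∑ x ∈ S, Jcoup d J α x y
      ≤ ∑ x ∈ S, 2 ^ α * ∑ z ∈ S, (if z ∈ ball1 x then g z else 0) := by
        rw [Finset.mul_sum]; exact Finset.sum_le_sum hlocal
    _ = 2 ^ α * ∑ z ∈ S, ∑ x ∈ S, (if z ∈ ball1 x then g z else 0) := by
        rw [← Finset.mul_sum, Finset.sum_comm]
    _ ≤ 2 ^ α * ∑ z ∈ S, ((2 * d + 1 : ℕ) : ℝ) * g z :=
        mul_le_mul_of_nonneg_left (Finset.sum_le_sum hcount) (by positivity)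
    _ = _ := by rw [← Finset.mul_sum]; ring

/-- A columnwise bound on finite sums passes to the sums over rows of summable families. -/
theorem mul_sum_tsum_le {ι κ : Type*} {S : Finset ι} {f g : ι → κ → ℝ} {a b : ℝ}
    (hf : ∀ x ∈ S, Summable (f x)) (hg : ∀ x ∈ S, Summable (g x))
    (h : ∀ y, a * ∑ x ∈ S, f x y ≤ b * ∑ x ∈ S, g x y) :
    a * ∑ x ∈ S, ∑' y, f x y ≤ b * ∑ x ∈ S, ∑' y, g x y := by
  rw [← Summable.tsum_finsetSum hf, ← Summable.tsum_finsetSum hg, ← tsum_mul_left,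
    ← tsum_mul_left]
  exact ((summable_sum hf).mul_left a).tsum_le_tsum h ((summable_sum hg).mul_left b)

/-- **Lower bound on the self-energy of the support of a contour** (the bound on the
term (I) in the proof of Proposition 4.3):
`(1/2)·∑_{x∈S}∑_{y∈ℤ^d} J_{xy}ψ(σ_x-σ_y) + (1/2)·∑_{x∈S}∑_{y∉S} J_{xy}ψ(σ_x-σ_y)`
is at least `(m/((2d+1)·2^{α+1}))·(J·c_α·|S| + F_S)`. -/
theorem contour_support_energy_bound
    (d q : ℕ) (hd : 1 ≤ d) (hq : 2 ≤ q) (J α m : ℝ) (hJ : 0 < J) (hα : (d : ℝ) < α)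
    (hm : 0 ≤ m)
    (ψ : ZMod q → ℝ) (hψ0 : ψ 0 = 0) (hψnonneg : ∀ n, 0 ≤ ψ n) (hψle : ∀ n, ψ n ≤ 1)
    (hψm : ∀ n : ZMod q, n ≠ 0 → m ≤ ψ n)
    (σ : Zd d → ZMod q) (S : Finset (Zd d))
    (hinc : ∀ z ∈ S, IsIncorrect σ z)
    (hclosed : ∀ z ∈ S, ∀ w ∈ ball1 z, IsIncorrect σ w → w ∈ S) :
    (m / (((2 * d + 1 : ℕ) : ℝ) * (2 : ℝ) ^ (α + 1))) *
        (J * cAlpha d α * (S.card : ℝ) + Fterm d J α S)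
      ≤ (1 / 2) * (∑ x ∈ S, ∑' y : Zd d, Jcoup d J α x y * ψ (σ x - σ y))
        + (1 / 2) * (∑ x ∈ S, ∑' y : Zd d,
            (if y ∈ S then 0 else Jcoup d J α x y * ψ (σ x - σ y))) := by
  have hα0 : 0 ≤ α := (Nat.cast_nonneg d).trans hα.le
  have hbound := sum_Jcoup_le hJ.le hα0 hψnonneg hψm hinc hclosed
  have hsJ : ∀ x ∈ S, Summable (Jcoup d J α x) := fun x _ => summable_Jcoup J hα x
  have hsψ : ∀ x ∈ S, Summable fun y => Jcoup d J α x y * ψ (σ x - σ y) := fun x hx =>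
    (hsJ x hx).of_nonneg_of_le
      (fun y => mul_nonneg (Jcoup_nonneg hJ.le α x y) (hψnonneg _))
      (fun y => mul_le_of_le_one_right (Jcoup_nonneg hJ.le α x y) (hψle _))
  have hcut : ∀ f : Zd d → ℝ, Summable f → Summable fun y => if y ∈ S then 0 else f y := by
    intro f hf
    refine (hf.indicator {y | y ∉ S}).congr fun y => ?_
    by_cases hy : y ∈ S <;> simp [hy]
  have hall := mul_sum_tsum_le hsJ hsψ hbound
  have hout := mul_sum_tsum_le (fun x hx => hcut _ (hsJ x hx)) (fun x hx => hcut _ (hsψ x hx))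
    (a := m) (b := ((2 * d + 1 : ℕ) : ℝ) * 2 ^ α) (fun y => by
      by_cases hy : y ∈ S
      · simp [hy]
      · simpa only [hy, if_false] using hbound y)
  simp only [tsum_Jcoup, Finset.sum_const, nsmul_eq_mul] at hall
  change m * Fterm d J α S ≤ _ at hout
  rw [div_mul_eq_mul_div, div_le_iff₀ (by positivity), Real.rpow_add_one two_ne_zero]
  linarith
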